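/- Let H be a 3-graph and let b > 1 and C_1 > 0 be real numbers such that ex(n, H) ≤ C_1·n^b for all integers n ≥ 1. Then for every constant C_2 > 0 there exists R = R(C_2) such that for every integer r > R one has m_H(r) > C_2·r^{2b/(b−1)} / (ln ln r)^{1 + 2b/(b−1)}. -/

import Mathlib

/-- A 3-graph: a finite vertex set `Fin n` together with a family of 3-element edges. -/
structure ThreeGraph where
  n : ℕ
  edges : Finset (Finset (Fin n))
  card_eq : ∀ e ∈ edges, e.card = 3

namespace ThreeGraph

/-- `G` contains a (not necessarily induced) copy of `H`. -/
def ContainsCopy (G H : ThreeGraph) : Prop :=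
  ∃ f : Fin H.n ↪ Fin G.n, ∀ e ∈ H.edges, e.image f ∈ G.edges

/-- `G` is `H`-free: it contains no subgraph isomorphic to `H`. -/
def Free (G H : ThreeGraph) : Prop := ¬ G.ContainsCopy H

/-- `G` admits a proper coloring with `r` colors: no edge is monochromatic. -/
def Colorable (G : ThreeGraph) (r : ℕ) : Prop :=
  ∃ c : Fin G.n → Fin r, ∀ e ∈ G.edges, ∃ u ∈ e, ∃ v ∈ e, c u ≠ c v

/-- `S` is an independent set in `G`: it contains no edge of `G`. -/
def IndepSet (G : ThreeGraph) (S : Finset (Fin G.n)) : Prop :=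
  ∀ e ∈ G.edges, ¬ e ⊆ S

/-- The degree of a vertex: the number of edges containing it. -/
def degree (G : ThreeGraph) (v : Fin G.n) : ℕ :=
  (G.edges.filter (fun e => v ∈ e)).card

end ThreeGraph

/-- Every 3-graph on `N` vertices contains a copy of `H` or an independent set of `t` vertices. -/
def RamseyProp (H : ThreeGraph) (t N : ℕ) : Prop :=
  ∀ G : ThreeGraph, G.n = N →
    G.ContainsCopy H ∨ ∃ S : Finset (Fin G.n), G.IndepSet S ∧ t ≤ S.card

/-- The Ramsey number `R(H, K_t)`: the least `N` such that every 3-graph on `N` vertices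
contains a copy of `H` or an independent set of `t` vertices. -/
noncomputable def ramsey (H : ThreeGraph) (t : ℕ) : ℕ :=
  sInf {N | RamseyProp H t N}

namespace ThreeGraph

/-- The edges of `G` contained in `S`. -/
def edgesIn (G : ThreeGraph) (S : Finset (Fin G.n)) : Finset (Finset (Fin G.n)) :=
  G.edges.filter (· ⊆ S)

/-- The subgraph of `G` induced on `S` is properly colorable with `N` colors. -/
def ColorableOn (G : ThreeGraph) (S : Finset (Fin G.n)) (N : ℕ) : Prop :=
  ∃ c : Fin G.n → ℕ, (∀ v ∈ S, c v < N) ∧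
    ∀ e ∈ G.edgesIn S, ∃ u ∈ e, ∃ v ∈ e, c u ≠ c v

theorem ColorableOn.empty (G : ThreeGraph) : G.ColorableOn ∅ 0 := by
  refine ⟨fun _ => 0, by simp, fun e he => ?_⟩
  obtain ⟨he, hS⟩ := Finset.mem_filter.1 he
  have := G.card_eq e he
  simp [Finset.subset_empty.1 hS] at this

theorem ColorableOn.of_sdiff {G : ThreeGraph} {S T : Finset (Fin G.n)} {k N : ℕ}
    (h₁ : G.ColorableOn (S \ T) k) (h₂ : G.ColorableOn T N) : G.ColorableOn S (k + N) := by
  obtain ⟨c₁, hc₁, he₁⟩ := h₁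
  obtain ⟨c₂, hc₂, he₂⟩ := h₂
  refine ⟨fun v => if v ∈ T then k + c₂ v else c₁ v, fun v hv => ?_, fun e he => ?_⟩
  · by_cases hT : v ∈ T
    · simpa [hT] using hc₂ v hT
    · have := hc₁ v (by simp [hv, hT])
      simp only [hT, if_false]
      omega
  · obtain ⟨he, hS⟩ := Finset.mem_filter.1 he
    by_cases hT : e ⊆ T
    · obtain ⟨u, hu, v, hv, huv⟩ := he₂ e (Finset.mem_filter.2 ⟨he, hT⟩)
      exact ⟨u, hu, v, hv, by simpa [hT hu, hT hv] using huv⟩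
    by_cases hd : e ⊆ S \ T
    · obtain ⟨u, hu, v, hv, huv⟩ := he₁ e (Finset.mem_filter.2 ⟨he, hd⟩)
      have hu' := (Finset.mem_sdiff.1 (hd hu)).2
      have hv' := (Finset.mem_sdiff.1 (hd hv)).2
      exact ⟨u, hu, v, hv, by simpa [hu', hv'] using huv⟩
    obtain ⟨u, hu, huT⟩ := Finset.not_subset.1 hT
    obtain ⟨v, hv, hvd⟩ := Finset.not_subset.1 hd
    have hvT : v ∈ T := by
      by_contra h
      exact hvd (Finset.mem_sdiff.2 ⟨hS hv, h⟩)
    refine ⟨u, hu, v, hv, ?_⟩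
    have := hc₁ u (Finset.mem_sdiff.2 ⟨hS hu, huT⟩)
    simp only [huT, hvT, if_true, if_false]
    omega

theorem ColorableOn.colorable {G : ThreeGraph} {N r : ℕ} (h : G.ColorableOn Finset.univ N)
    (hr : N ≤ r) : G.Colorable r := by
  obtain ⟨c, hc, he⟩ := h
  refine ⟨fun v => ⟨c v, (hc v (Finset.mem_univ v)).trans_le hr⟩, fun e h => ?_⟩
  obtain ⟨u, hu, v, hv, huv⟩ := he e (Finset.mem_filter.2 ⟨h, Finset.subset_univ e⟩)
  exact ⟨u, hu, v, hv, by simpa using huv⟩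

theorem card_monochromatic_mul_sq_le {n k : ℕ} (e : Finset (Fin n)) (he : e.card = 3) :
    (Finset.univ.filter fun c : Fin n → Fin k => ∀ u ∈ e, ∀ v ∈ e, c u = c v).card * k ^ 2
      ≤ k ^ n := by
  obtain ⟨x, y, z, hxy, hxz, hyz, rfl⟩ := Finset.card_eq_three.1 he
  set M := Finset.univ.filter fun c : Fin n → Fin k =>
    ∀ u ∈ ({x, y, z} : Finset (Fin n)), ∀ v ∈ ({x, y, z} : Finset (Fin n)), c u = c v
  have hmem : ∀ c ∈ M, c y = c x ∧ c z = c x := by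
    intro c hc
    have := (Finset.mem_filter.1 hc).2
    exact ⟨this y (by simp) x (by simp), this z (by simp) x (by simp)⟩
  have := Finset.card_le_card_of_injOn (s := M ×ˢ (Finset.univ : Finset (Fin k × Fin k)))
    (t := (Finset.univ : Finset (Fin n → Fin k)))
    (fun p => Function.update (Function.update p.1 y p.2.1) z p.2.2)
    (fun _ _ => Finset.mem_coe.2 (Finset.mem_univ _)) (by
      rintro ⟨c, a, b⟩ hp ⟨c', a', b'⟩ hp' h
      have hc := hmem c (Finset.mem_product.1 hp).1
      have hc' := hmem c' (Finset.mem_product.1 hp').1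
      have hv : ∀ v, Function.update (Function.update c y a) z b v =
        Function.update (Function.update c' y a') z b' v := fun v => congrFun h v
      have hx := hv x
      have hy := hv y
      have hz := hv z
      simp only [Function.update_apply, hxy, hxz, hyz, if_true, if_false] at hx hy hz
      subst hy hz
      have : c = c' := by
        ext1 v
        by_cases h1 : v = z
        · rw [h1, hc.2, hc'.2, hx]
        by_cases h2 : v = y
        · rw [h2, hc.1, hc'.1, hx]
        simpa [Function.update_apply, h1, h2] using hv v
      rw [this])
  simpa [Finset.card_product, sq] using this

theorem exists_coloring_few_monochromatic {n k : ℕ} (hk : 0 < k)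
    (E : Finset (Finset (Fin n))) (hE : ∀ e ∈ E, e.card = 3) :
    ∃ c : Fin n → Fin k,
      (E.filter fun e => ∀ u ∈ e, ∀ v ∈ e, c u = c v).card * k ^ 2 ≤ E.card := by
  by_contra! h
  have : NeZero k := ⟨hk.ne'⟩
  have hlt := Finset.sum_lt_sum_of_nonempty
    (Finset.univ_nonempty (α := Fin n → Fin k)) (fun c _ => h c)
  have hdc := Finset.sum_card_bipartiteAbove_eq_sum_card_bipartiteBelow
    (s := (Finset.univ : Finset (Fin n → Fin k))) (t := E)
    fun c e => ∀ u ∈ e, ∀ v ∈ e, c u = c v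
  simp only [Finset.bipartiteAbove, Finset.bipartiteBelow] at hdc
  rw [← Finset.sum_mul, hdc, Finset.sum_mul] at hlt
  have hle := Finset.sum_le_sum fun e he => card_monochromatic_mul_sq_le (k := k) e (hE e he)
  simp only [Finset.sum_const, Finset.card_univ, Fintype.card_pi, Fintype.card_fin,
    Finset.prod_const, smul_eq_mul] at hlt hle
  rw [mul_comm] at hlt
  exact absurd (hlt.trans_le hle) (lt_irrefl _)

/-- A set of vertices spanning few edges is `k`-colorable up to a small exceptional set. -/
theorem exists_small_colorableOn_sdiff (G : ThreeGraph) (S : Finset (Fin G.n)) {k : ℕ}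
    (hk : 0 < k) :
    ∃ T ⊆ S, T.card * k ^ 2 ≤ (G.edgesIn S).card ∧ G.ColorableOn (S \ T) k := by
  have hE : ∀ e ∈ G.edgesIn S, e.card = 3 := fun e he => G.card_eq e (Finset.mem_filter.1 he).1
  obtain ⟨c, hc⟩ := exists_coloring_few_monochromatic hk (G.edgesIn S) hE
  set M := (G.edgesIn S).filter fun e => ∀ u ∈ e, ∀ v ∈ e, c u = c v
  have hne : ∀ e : M, (e : Finset (Fin G.n)).Nonempty := fun e => by
    rw [← Finset.card_pos, hE e (Finset.mem_filter.1 e.2).1]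
    norm_num
  choose w hw using hne
  refine ⟨M.attach.image w, ?_, ?_, fun v => c v, fun v _ => (c v).2, fun e he => ?_⟩
  · intro v hv
    obtain ⟨e, -, rfl⟩ := Finset.mem_image.1 hv
    exact (Finset.mem_filter.1 (Finset.mem_filter.1 e.2).1).2 (hw e)
  · refine le_trans (Nat.mul_le_mul_right _ ?_) hc
    simpa using Finset.card_image_le (s := M.attach) (f := w)
  · obtain ⟨he, hs⟩ := Finset.mem_filter.1 he
    by_contra! hmono
    have heM : e ∈ M := Finset.mem_filter.2
      ⟨Finset.mem_filter.2 ⟨he, hs.trans Finset.sdiff_subset⟩,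
        fun u hu v hv => Fin.ext (hmono u hu v hv)⟩
    exact (Finset.mem_sdiff.1 (hs (hw ⟨e, heM⟩))).2
      (Finset.mem_image_of_mem w (Finset.mem_attach M _))

/-- The edges of `G` contained in `S`, with the vertices of `S` indexed by `Fin S.card`. -/
def inducedEdges (G : ThreeGraph) (S : Finset (Fin G.n)) : Finset (Finset (Fin S.card)) :=
  Finset.univ.filter fun e => e.map (S.orderEmbOfFin rfl).toEmbedding ∈ G.edges

theorem mem_inducedEdges {G : ThreeGraph} {S : Finset (Fin G.n)} {e : Finset (Fin S.card)} :
    e ∈ G.inducedEdges S ↔ e.map (S.orderEmbOfFin rfl).toEmbedding ∈ G.edges := by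
  simp [inducedEdges]

/-- The subgraph induced on `S`, with vertices indexed by `Fin S.card`. -/
def induce (G : ThreeGraph) (S : Finset (Fin G.n)) : ThreeGraph where
  n := S.card
  edges := G.inducedEdges S
  card_eq e he := by simpa using G.card_eq _ (mem_inducedEdges.1 he)

theorem Free.induce {G H : ThreeGraph} (h : G.Free H) (S : Finset (Fin G.n)) :
    (G.induce S).Free H := by
  rintro ⟨f, hf⟩
  change Fin H.n ↪ Fin S.card at f
  refine h ⟨f.trans (S.orderEmbOfFin rfl).toEmbedding, fun e he => ?_⟩
  have he' : e.image f ∈ G.inducedEdges S := hf e he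
  have := mem_inducedEdges.1 he'
  rwa [Finset.map_eq_image, Finset.image_image] at this

theorem card_edgesIn_le_card_edges_induce (G : ThreeGraph) (S : Finset (Fin G.n)) :
    (G.edgesIn S).card ≤ (G.induce S).edges.card := by
  change _ ≤ (G.inducedEdges S).card
  refine Finset.card_le_card_of_surjOn
    (fun e => e.map (S.orderEmbOfFin rfl).toEmbedding) fun e he => ?_
  obtain ⟨he, hS⟩ := Finset.mem_filter.1 (Finset.mem_coe.1 he)
  rw [← Finset.map_orderEmbOfFin_univ S rfl] at hS
  obtain ⟨u, -, rfl⟩ := Finset.subset_map_iff.1 hS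
  exact ⟨u, Finset.mem_coe.2 (mem_inducedEdges.2 he), rfl⟩

/-- If every nonempty vertex set `S` spans at most `C * |S| ^ b` edges, then every `S` can be
colored with `O(|S| ^ ((b - 1) / 2))` colors. -/
theorem exists_colorableOn_le {b C : ℝ} (hb : 1 < b) (hC : 0 < C) :
    ∃ K : ℝ, 0 < K ∧ ∀ G : ThreeGraph,
      (∀ S : Finset (Fin G.n), S.Nonempty → ((G.edgesIn S).card : ℝ) ≤ C * (S.card : ℝ) ^ b) →
      ∀ S : Finset (Fin G.n), ∃ N : ℕ,
        (N : ℝ) ≤ K * (S.card : ℝ) ^ ((b - 1) / 2) ∧ G.ColorableOn S N := by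
  set β := (b - 1) / 2 with hβ
  have hβ0 : 0 < β := by rw [hβ]; linarith
  set q : ℝ := (1 / 2 : ℝ) ^ β with hq
  have hq1 : q < 1 := Real.rpow_lt_one (by norm_num) (by norm_num) hβ0
  set D : ℝ := √(2 * C) + 1 with hD
  have hD0 : 0 < D := by positivity
  refine ⟨D / (1 - q), div_pos hD0 (by linarith), fun G hG S => ?_⟩
  set K := D / (1 - q) with hK
  have hK0 : 0 < K := div_pos hD0 (by linarith)
  have hKq : D + K * q = K := by
    have : (1 - q) ≠ 0 := by linarith
    rw [hK]; field_simp; ring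
  induction hs : S.card using Nat.strong_induction_on generalizing S with
  | _ s ih =>
  subst hs
  rcases S.eq_empty_or_nonempty with rfl | hne
  · exact ⟨0, by simp [Real.zero_rpow hβ0.ne'], ColorableOn.empty G⟩
  have hs1 : (1 : ℝ) ≤ S.card := by exact_mod_cast hne.card_pos
  have hs0 : (0 : ℝ) < S.card := by linarith
  have hsβ : 1 ≤ (S.card : ℝ) ^ β := Real.one_le_rpow hs1 hβ0.le
  set k := ⌈√(2 * C) * (S.card : ℝ) ^ β⌉₊ with hk
  have hklow : √(2 * C) * (S.card : ℝ) ^ β ≤ k := Nat.le_ceil _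
  have hkpos : 0 < k := Nat.ceil_pos.2 (by positivity)
  have hkup : (k : ℝ) ≤ D * (S.card : ℝ) ^ β := by
    have := Nat.ceil_lt_add_one (a := √(2 * C) * (S.card : ℝ) ^ β) (by positivity)
    rw [hD]
    linarith
  obtain ⟨T, -, hTcard, hT⟩ := G.exists_small_colorableOn_sdiff S hkpos
  have hsq : 2 * C * (S.card : ℝ) ^ b ≤ S.card * (k : ℝ) ^ 2 := by
    have h1 : (√(2 * C) * (S.card : ℝ) ^ β) ^ 2 ≤ (k : ℝ) ^ 2 :=
      pow_le_pow_left₀ (by positivity) hklow 2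
    have h2 : (S.card : ℝ) ^ b = S.card * ((S.card : ℝ) ^ β) ^ 2 := by
      rw [← Real.rpow_natCast ((S.card : ℝ) ^ β), ← Real.rpow_mul hs0.le]
      nth_rw 2 [← Real.rpow_one (S.card : ℝ)]
      rw [← Real.rpow_add hs0]
      congr 1
      rw [hβ]; push_cast; ring
    rw [mul_pow, Real.sq_sqrt (by positivity)] at h1
    rw [h2]
    nlinarith
  have hTs : (T.card : ℝ) ≤ 1 / 2 * S.card := by
    have h1 : (T.card : ℝ) * (k : ℝ) ^ 2 ≤ (G.edgesIn S).card := by exact_mod_cast hTcard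
    have h2 := hG S hne
    have h3 : (0 : ℝ) < (k : ℝ) ^ 2 := by positivity
    refine le_of_mul_le_mul_right ?_ h3
    linarith
  have hlt : T.card < S.card := by
    have : (T.card : ℝ) < S.card := by linarith
    exact_mod_cast this
  obtain ⟨N, hN, hcol⟩ := ih T.card hlt T rfl
  refine ⟨k + N, ?_, hT.of_sdiff hcol⟩
  have hTβ : (T.card : ℝ) ^ β ≤ q * (S.card : ℝ) ^ β := by
    rw [hq, ← Real.mul_rpow (by norm_num) hs0.le]
    exact Real.rpow_le_rpow (by positivity) hTs hβ0.le
  push_cast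
  calc (k : ℝ) + N ≤ D * (S.card : ℝ) ^ β + K * (q * (S.card : ℝ) ^ β) :=
        add_le_add hkup (hN.trans (mul_le_mul_of_nonneg_left hTβ hK0.le))
    _ = (D + K * q) * (S.card : ℝ) ^ β := by ring
    _ = K * (S.card : ℝ) ^ β := by rw [hKq]

end ThreeGraph

/-- If `ex(n, H) ≤ C₁·n^b` for all `n ≥ 1` (i.e. every `H`-free 3-graph on
`n ≥ 1` vertices has at most `C₁·n^b` edges), with `b > 1`, `C₁ > 0`, then for every `C₂ > 0`
there is `R` such that for all `r > R`,
`m_H(r) > C₂·r^(2b/(b−1)) / (ln ln r)^(1 + 2b/(b−1))`. -/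
theorem mH_lower_of_turan_upper
    (H : ThreeGraph) (b C₁ : ℝ) (hb : 1 < b) (hC₁ : 0 < C₁)
    (hex : ∀ G : ThreeGraph, 1 ≤ G.n → G.Free H → (G.edges.card : ℝ) ≤ C₁ * (G.n : ℝ) ^ b) :
    ∀ C₂ : ℝ, 0 < C₂ → ∃ R : ℕ, ∀ r : ℕ, R < r →
      ∀ G : ThreeGraph, G.Free H → ¬ G.Colorable r →
        C₂ * (r : ℝ) ^ (2 * b / (b - 1)) /
            Real.log (Real.log r) ^ (1 + 2 * b / (b - 1))
          < (G.edges.card : ℝ) := by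
  intro C₂ hC₂
  obtain ⟨K, hK, hcol⟩ := ThreeGraph.exists_colorableOn_le hb hC₁
  set β := (b - 1) / 2 with hβ
  have hβ0 : 0 < β := by rw [hβ]; linarith
  set γ := 2 * b / (b - 1) with hγ
  have hb1 : b - 1 ≠ 0 := by linarith
  have hγβ : γ = 1 / β + 2 := by rw [hγ, hβ]; field_simp; ring
  have hγ0 : 0 < 1 + γ := by rw [hγβ]; positivity
  set ε : ℝ := (1 / (2 * K)) ^ (1 / β) with hε
  have hε0 : 0 < ε := by positivity
  have hL : Filter.Tendsto (fun r : ℕ => Real.log (Real.log r)) Filter.atTop Filter.atTop :=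
    Real.tendsto_log_atTop.comp (Real.tendsto_log_atTop.comp tendsto_natCast_atTop_atTop)
  have hev := (hL.eventually_gt_atTop 0).and
    (((tendsto_rpow_atTop hγ0).comp hL).eventually_ge_atTop (9 * C₂ / ε))
  obtain ⟨R, hR⟩ := Filter.eventually_atTop.1 hev
  refine ⟨max R 2, fun r hr G hfree hncol => ?_⟩
  obtain ⟨hLpos, hLge⟩ := hR r (by omega)
  simp only [Function.comp] at hLge
  set P := Real.log (Real.log r) ^ (1 + γ)
  have hP0 : 0 < P := Real.rpow_pos_of_pos hLpos _
  by_contra! hm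
  refine hncol ?_
  have hr0 : (0 : ℝ) < r := by exact_mod_cast (by omega : 0 < r)
  obtain ⟨T, -, hTcard, hT⟩ :=
    G.exists_small_colorableOn_sdiff Finset.univ (k := r / 2) (by omega)
  obtain ⟨N, hN, hTN⟩ := hcol G (fun S hS =>
    (Nat.cast_le.2 (G.card_edgesIn_le_card_edges_induce S)).trans
      (hex (G.induce S) hS.card_pos (hfree.induce S))) T
  refine (hT.of_sdiff hTN).colorable ?_
  have hk : (r : ℝ) / 3 ≤ (r / 2 : ℕ) := by
    have : r ≤ 3 * (r / 2) := by omega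
    have : (r : ℝ) ≤ 3 * (r / 2 : ℕ) := by exact_mod_cast this
    linarith
  have hTm : (T.card : ℝ) * ((r : ℝ) / 3) ^ 2 ≤ C₂ * (r : ℝ) ^ γ / P := by
    calc (T.card : ℝ) * ((r : ℝ) / 3) ^ 2 ≤ T.card * ((r / 2 : ℕ) : ℝ) ^ 2 := by gcongr
      _ ≤ ((G.edgesIn Finset.univ).card : ℝ) := by exact_mod_cast hTcard
      _ ≤ (G.edges.card : ℝ) := by exact_mod_cast Finset.card_filter_le _ _
      _ ≤ _ := hm
  have hrγ : (r : ℝ) ^ γ = (r : ℝ) ^ (1 / β) * (r : ℝ) ^ 2 := by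
    rw [hγβ, Real.rpow_add hr0, Real.rpow_two]
  have hTε : (T.card : ℝ) ≤ ε * (r : ℝ) ^ (1 / β) := by
    have h1 : 9 * C₂ / P ≤ ε := by
      rw [div_le_iff₀ hε0] at hLge
      rw [div_le_iff₀ hP0]
      linarith
    have h2 : (T.card : ℝ) * (r : ℝ) ^ 2 ≤ (9 * C₂ / P * (r : ℝ) ^ (1 / β)) * (r : ℝ) ^ 2 := by
      rw [hrγ] at hTm
      calc (T.card : ℝ) * (r : ℝ) ^ 2 = 9 * (T.card * ((r : ℝ) / 3) ^ 2) := by ring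
        _ ≤ 9 * (C₂ * ((r : ℝ) ^ (1 / β) * (r : ℝ) ^ 2) / P) := by gcongr
        _ = _ := by ring
    exact (le_of_mul_le_mul_right h2 (by positivity)).trans (by gcongr)
  have hNr : (N : ℝ) ≤ r / 2 := by
    calc (N : ℝ) ≤ K * (T.card : ℝ) ^ β := hN
      _ ≤ K * (ε * (r : ℝ) ^ (1 / β)) ^ β := by gcongr
      _ = r / 2 := by
        rw [hε, ← Real.mul_rpow (by positivity) hr0.le, ← Real.rpow_mul (by positivity),
          one_div_mul_cancel hβ0.ne', Real.rpow_one]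
        field_simp
  have : 2 * N ≤ r := by
    have : (2 : ℝ) * N ≤ r := by linarith
    exact_mod_cast this
  omega
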